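/- arXiv:2312.08312 — 3 statements merged into one kernel-verified Lean document; each statement's English description precedes it below -/
import Mathlib

section
/- Fix a nonnegative integer d and nonzero complex parameters q, ρ, σ such that q^m ≠ 1 for all integers 1 ≤ m ≤ d + 1, ρ q^m ≠ 1 for all integers 1 ≤ m ≤ d + 1, and ρ ≠ σ q^m for all integers 1 ≤ m ≤ d + 1. Then for all integers 0 ≤ x ≤ d and 0 ≤ i ≤ d, the following contiguity relation for the normalized dual q-Hahn functions holds: ((q^{x} − q^{d+1})(σ q^{d+1} − q^{−1−x})/(ρ − σ q^{d+1})) · p_{x,i}(d; ρ, σ; q) = (q^{i+1} − 1) · p_{x,i+1}(d+1; ρ, σ; q) + (q^{d+1} − q^{i}) · p_{x,i}(d+1; ρ, σ; q). -/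
/-- q-Pochhammer symbol `(a;q)_k`. -/
noncomputable def qpoch (a q : ℂ) (k : ℕ) : ℂ := ∏ l ∈ Finset.range k, (1 - a * q ^ l)

/-- q-binomial coefficient `[n choose i]_q` (set to `0` when `i > n`). -/
noncomputable def qbinom (q : ℂ) (n i : ℕ) : ℂ :=
  if i ≤ n then qpoch q q n / (qpoch q q i * qpoch q q (n - i)) else 0

/-- Normalized dual q-Hahn function `p_{x,i}(d; ρ, σ; q)`, with the convention that it
vanishes for negative `i`. -/
noncomputable def dualQHahnP (d : ℕ) (ρ σ q : ℂ) (x : ℕ) (i : ℤ) : ℂ :=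
  if i < 0 then 0
  else
    (-1 : ℂ) ^ i.toNat * q ^ (((i.toNat : ℤ) * ((i.toNat : ℤ) - 3 - 2 * (d : ℤ))) / 2) *
        qbinom q d i.toNat * qpoch (q * ρ) q i.toNat /
        (σ ^ i.toNat * qpoch (q ^ (-(d : ℤ)) * ρ / σ) q i.toNat) *
      ∑ k ∈ Finset.range (min i.toNat x + 1),
        qpoch (q ^ (-(i.toNat : ℤ))) q k * qpoch (q ^ (-(x : ℤ))) q k *
            qpoch (σ * q ^ (x + 1)) q k * q ^ k /
          (qpoch (ρ * q) q k * qpoch (q ^ (-(d : ℤ))) q k * qpoch q q k)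

theorem qpoch_zero (a q : ℂ) : qpoch a q 0 = 1 := by simp [qpoch]

theorem qpoch_succ (a q : ℂ) (k : ℕ) : qpoch a q (k + 1) = qpoch a q k * (1 - a * q ^ k) :=
  Finset.prod_range_succ _ _

theorem qpoch_succ' (a q : ℂ) (k : ℕ) : qpoch a q (k + 1) = (1 - a) * qpoch (a * q) q k := by
  simp only [qpoch, Finset.prod_range_succ', pow_zero, mul_one]
  rw [mul_comm]
  congr 1
  exact Finset.prod_congr rfl fun l _ => by ring

theorem qpoch_ne_zero {a q : ℂ} {k : ℕ} (h : ∀ l < k, a * q ^ l ≠ 1) : qpoch a q k ≠ 0 :=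
  Finset.prod_ne_zero_iff.2 fun l hl => sub_ne_zero.2 (h l (Finset.mem_range.1 hl)).symm

theorem qpoch_zpow_neg_eq_zero {q : ℂ} (hq : q ≠ 0) {n k : ℕ} (h : n < k) :
    qpoch (q ^ (-(n : ℤ))) q k = 0 :=
  Finset.prod_eq_zero (Finset.mem_range.2 h) (by simp [hq])

/-- The factor of the normalized dual q-Hahn function in front of the hypergeometric sum. -/
noncomputable def dualQHahnCoeff (d : ℕ) (ρ σ q : ℂ) (i : ℕ) : ℂ :=
  (-1 : ℂ) ^ i * q ^ (((i : ℤ) * ((i : ℤ) - 3 - 2 * (d : ℤ))) / 2) *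
    qbinom q d i * qpoch (q * ρ) q i / (σ ^ i * qpoch (q ^ (-(d : ℤ)) * ρ / σ) q i)

/-- The part of the `k`-th hypergeometric term that does not depend on the variable `x`. -/
noncomputable def dualQHahnWeight (d : ℕ) (ρ q : ℂ) (i k : ℕ) : ℂ :=
  qpoch (q ^ (-(i : ℤ))) q k * q ^ k /
    (qpoch (ρ * q) q k * qpoch (q ^ (-(d : ℤ))) q k * qpoch q q k)

/-- The part of the `k`-th hypergeometric term that depends on the variable `x`. -/
noncomputable def dualQHahnBasis (σ q : ℂ) (x k : ℕ) : ℂ :=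
  qpoch (q ^ (-(x : ℤ))) q k * qpoch (σ * q ^ (x + 1)) q k

theorem dualQHahnWeight_zero (d : ℕ) (ρ q : ℂ) (i : ℕ) : dualQHahnWeight d ρ q i 0 = 1 := by
  simp [dualQHahnWeight, qpoch_zero]

theorem dualQHahnWeight_eq_zero {q : ℂ} (hq : q ≠ 0) (d : ℕ) (ρ : ℂ) {i k : ℕ} (h : i < k) :
    dualQHahnWeight d ρ q i k = 0 := by
  rw [dualQHahnWeight, qpoch_zpow_neg_eq_zero hq h, zero_mul, zero_div]

theorem dualQHahnP_natCast {q : ℂ} (hq : q ≠ 0) (d : ℕ) (ρ σ : ℂ) (x : ℕ) {i n : ℕ}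
    (h : i < n) :
    dualQHahnP d ρ σ q x (i : ℤ) = dualQHahnCoeff d ρ σ q i *
      ∑ k ∈ Finset.range n, dualQHahnWeight d ρ q i k * dualQHahnBasis σ q x k := by
  have h0 : ¬ ((i : ℤ) < 0) := by omega
  simp only [dualQHahnP, h0, if_false, Int.toNat_natCast, dualQHahnCoeff]
  congr 1
  rw [Finset.sum_congr rfl fun k _ => show _ =
    dualQHahnWeight d ρ q i k * dualQHahnBasis σ q x k by
      simp only [dualQHahnWeight, dualQHahnBasis]; ring]
  refine Finset.sum_subset (fun k hk => ?_) fun k _ hk => ?_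
  · simp only [Finset.mem_range] at hk ⊢
    omega
  · simp only [Finset.mem_range] at hk
    rcases lt_or_ge i k with hik | hik
    · rw [dualQHahnWeight_eq_zero hq d ρ hik, zero_mul]
    · rw [dualQHahnBasis, qpoch_zpow_neg_eq_zero hq (show x < k by omega)]
      simp

theorem dualQHahnBasis_succ {q : ℂ} (hq : q ≠ 0) (σ : ℂ) {d k : ℕ} (x : ℕ) :
    (q ^ x - q ^ (d + 1)) * (σ * q ^ (d + 1) - q ^ (-1 - (x : ℤ))) * dualQHahnBasis σ q x k =
      (1 - q ^ ((d : ℤ) + 1 - k)) * (σ * q ^ (d + 1 + k) - q⁻¹) * dualQHahnBasis σ q x k -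
        q ^ ((d : ℤ) - k) * dualQHahnBasis σ q x (k + 1) := by
  simp only [dualQHahnBasis, qpoch_succ, zpow_sub₀ hq, zpow_add₀ hq, zpow_neg, zpow_natCast,
    zpow_one, pow_add, pow_one]
  have hx : q ^ x ≠ 0 := pow_ne_zero _ hq
  have hk : q ^ k ≠ 0 := pow_ne_zero _ hq
  generalize qpoch (q ^ x)⁻¹ q k = A
  generalize qpoch _ q k = B
  field_simp
  ring

/-- The coefficientwise form of the contiguity relation. -/
theorem dualQHahnWeight_contiguity_succ {d : ℕ} {q ρ : ℂ} (σ : ℂ) (hq : q ≠ 0)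
    (hq1 : ∀ m : ℕ, 1 ≤ m → m ≤ d + 1 → q ^ m ≠ 1)
    (hρ : ∀ m : ℕ, 1 ≤ m → m ≤ d + 1 → ρ * q ^ m ≠ 1) {i j : ℕ} (hi : i ≤ d) (hj : j ≤ i) :
    q ^ ((d : ℤ) - j) * dualQHahnWeight d ρ q i j -
        (1 - q ^ ((d : ℤ) + 1 - (j + 1 : ℕ))) * (σ * q ^ (d + 1 + (j + 1)) - q⁻¹) *
          dualQHahnWeight d ρ q i (j + 1) =
      (1 - q ^ (d + 1)) *
        (q⁻¹ * (1 - ρ * q ^ (i + 1)) * dualQHahnWeight (d + 1) ρ q (i + 1) (j + 1) -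
          (σ * q ^ (d + 1) - q ^ i * ρ) * dualQHahnWeight (d + 1) ρ q i (j + 1)) := by
  have hshift (n : ℕ) : q ^ (-((n + 1 : ℕ) : ℤ)) * q = q ^ (-(n : ℤ)) := by
    rw [← zpow_add_one₀ hq]; congr 1; push_cast; ring
  have hr : qpoch (ρ * q) q j ≠ 0 := qpoch_ne_zero fun l hl => by
    have := hρ (l + 1) (by omega) (by omega)
    rwa [pow_succ', ← mul_assoc] at this
  have hr' : 1 - ρ * q * q ^ j ≠ 0 := sub_ne_zero.2 <| by
    have := (hρ (j + 1) (by omega) (by omega)).symm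
    rwa [pow_succ', ← mul_assoc] at this
  have hqq : qpoch q q j ≠ 0 := qpoch_ne_zero fun l hl => by
    have := hq1 (l + 1) (by omega) (by omega)
    rwa [pow_succ'] at this
  have hqq' : 1 - q * q ^ j ≠ 0 := sub_ne_zero.2 <| by
    have := (hq1 (j + 1) (by omega) (by omega)).symm
    rwa [pow_succ'] at this
  have hdpow {l : ℕ} (hl : l < d) : q ^ (-(d : ℤ)) * q ^ l ≠ 1 := fun h => by
    refine hq1 (d - l) (by omega) (by omega) ?_
    rw [zpow_neg, zpow_natCast, inv_mul_eq_one₀ (pow_ne_zero _ hq)] at h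
    rw [← mul_left_inj' (pow_ne_zero l hq), ← pow_add, Nat.sub_add_cancel hl.le, h, one_mul]
  have hd : qpoch (q ^ (-(d : ℤ))) q j ≠ 0 := qpoch_ne_zero fun l hl => hdpow (by omega)
  have hD : 1 - q ^ d * q ≠ 0 := sub_ne_zero.2 <| by
    have := (hq1 (d + 1) (by omega) le_rfl).symm
    rwa [pow_succ] at this
  have hQ : q ^ d ≠ 0 := pow_ne_zero _ hq
  have hI : q ^ i ≠ 0 := pow_ne_zero _ hq
  have hJ : q ^ j ≠ 0 := pow_ne_zero _ hq
  -- the recursion for the weights, valid also when a denominator vanishes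
  have hw : (1 - q ^ ((d : ℤ) + 1 - (j + 1 : ℕ))) * dualQHahnWeight d ρ q i (j + 1) =
      -(q ^ d / q ^ j) * (1 - q ^ j / q ^ i) * (qpoch (q ^ (-(i : ℤ))) q j * q ^ j * q /
        (qpoch (ρ * q) q j * (1 - ρ * q * q ^ j) * qpoch (q ^ (-(d : ℤ))) q j *
          (qpoch q q j * (1 - q * q ^ j)))) := by
    have hz : q ^ ((d : ℤ) + 1 - (j + 1 : ℕ)) = q ^ d / q ^ j := by
      rw [show ((d : ℤ) + 1 - (j + 1 : ℕ)) = d - j by push_cast; ring, zpow_sub₀ hq]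
      simp
    rw [hz]
    rcases hj.lt_or_eq with hji | rfl
    · have h1 : 1 - q ^ (-(d : ℤ)) * q ^ j ≠ 0 := sub_ne_zero.2 (hdpow (by omega)).symm
      simp only [dualQHahnWeight, qpoch_succ, pow_succ]
      generalize qpoch (q ^ (-(i : ℤ))) q j = A at *
      generalize qpoch (q ^ (-(d : ℤ))) q j = B at *
      simp only [zpow_neg, zpow_natCast] at *
      have h2 : q ^ d - q ^ j ≠ 0 := fun h => h1 (by rw [← sub_eq_zero.1 h]; field_simp; simp)
      have h3 : 1 - (q ^ d)⁻¹ * q ^ j = (q ^ d - q ^ j) / q ^ d := by field_simp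
      rw [h3]
      field_simp
      ring
    · rw [dualQHahnWeight_eq_zero hq d ρ (Nat.lt_succ_self j), div_self hJ]
      ring
  have e1 : dualQHahnWeight (d + 1) ρ q (i + 1) (j + 1) =
      (1 - q ^ (-((i + 1 : ℕ) : ℤ))) * qpoch (q ^ (-(i : ℤ))) q j * q ^ (j + 1) /
        (qpoch (ρ * q) q (j + 1) * ((1 - q ^ (-((d + 1 : ℕ) : ℤ))) *
          qpoch (q ^ (-(d : ℤ))) q j) * qpoch q q (j + 1)) := by
    rw [dualQHahnWeight, qpoch_succ' (q ^ (-((i + 1 : ℕ) : ℤ))),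
      qpoch_succ' (q ^ (-((d + 1 : ℕ) : ℤ))), hshift, hshift]
  have e2 : dualQHahnWeight (d + 1) ρ q i (j + 1) =
      qpoch (q ^ (-(i : ℤ))) q j * (1 - q ^ (-(i : ℤ)) * q ^ j) * q ^ (j + 1) /
        (qpoch (ρ * q) q (j + 1) * ((1 - q ^ (-((d + 1 : ℕ) : ℤ))) *
          qpoch (q ^ (-(d : ℤ))) q j) * qpoch q q (j + 1)) := by
    rw [dualQHahnWeight, qpoch_succ (q ^ (-(i : ℤ))),
      qpoch_succ' (q ^ (-((d + 1 : ℕ) : ℤ))), hshift]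
  rw [mul_right_comm, hw, e1, e2, dualQHahnWeight]
  simp only [qpoch_succ]
  generalize qpoch (q ^ (-(i : ℤ))) q j = A at *
  generalize qpoch (q ^ (-(d : ℤ))) q j = B at *
  obtain ⟨U, hU⟩ : ∃ U, U = 1 - ρ * q * q ^ j := ⟨_, rfl⟩
  obtain ⟨V, hV⟩ : ∃ V, V = 1 - q * q ^ j := ⟨_, rfl⟩
  rw [← hU] at hr' ⊢
  rw [← hV] at hqq' ⊢
  simp only [zpow_neg, zpow_natCast, zpow_sub₀ hq, pow_succ, pow_add]
  have h3 : 1 - (q ^ d * q)⁻¹ = -(1 - q ^ d * q) / (q ^ d * q) := by field_simp; ring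
  rw [h3]
  field_simp
  rw [hU, hV]
  ring

theorem dualQHahnWeight_sum_contiguity {d : ℕ} {q ρ : ℂ} (σ : ℂ) (hq : q ≠ 0)
    (hq1 : ∀ m : ℕ, 1 ≤ m → m ≤ d + 1 → q ^ m ≠ 1)
    (hρ : ∀ m : ℕ, 1 ≤ m → m ≤ d + 1 → ρ * q ^ m ≠ 1) (x : ℕ) {i : ℕ} (hi : i ≤ d) :
    -((q ^ x - q ^ (d + 1)) * (σ * q ^ (d + 1) - q ^ (-1 - (x : ℤ)))) *
        ∑ k ∈ Finset.range (i + 2), dualQHahnWeight d ρ q i k * dualQHahnBasis σ q x k =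
      (1 - q ^ (d + 1)) *
        (q⁻¹ * (1 - ρ * q ^ (i + 1)) * ∑ k ∈ Finset.range (i + 2),
            dualQHahnWeight (d + 1) ρ q (i + 1) k * dualQHahnBasis σ q x k -
          (σ * q ^ (d + 1) - q ^ i * ρ) * ∑ k ∈ Finset.range (i + 2),
            dualQHahnWeight (d + 1) ρ q i k * dualQHahnBasis σ q x k) := by
  set w := dualQHahnWeight d ρ q i with hw
  set φ := dualQHahnBasis σ q x with hφ
  have hL : -((q ^ x - q ^ (d + 1)) * (σ * q ^ (d + 1) - q ^ (-1 - (x : ℤ)))) *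
        ∑ k ∈ Finset.range (i + 2), w k * φ k =
      ∑ k ∈ Finset.range (i + 2), q ^ ((d : ℤ) - k) * w k * φ (k + 1) -
        ∑ k ∈ Finset.range (i + 2),
          (1 - q ^ ((d : ℤ) + 1 - k)) * (σ * q ^ (d + 1 + k) - q⁻¹) * w k * φ k := by
    rw [Finset.mul_sum, ← Finset.sum_sub_distrib]
    refine Finset.sum_congr rfl fun k _ => ?_
    linear_combination (-w k) * dualQHahnBasis_succ (d := d) (k := k) hq σ x
  have hlast : w (i + 1) = 0 := dualQHahnWeight_eq_zero hq d ρ (Nat.lt_succ_self i)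
  rw [hL, Finset.sum_range_succ _ (i + 1), hlast, mul_zero, zero_mul, add_zero]
  simp only [Finset.sum_range_succ' _ (i + 1)]
  have hS := Finset.sum_congr (rfl : Finset.range (i + 1) = _) fun j hj => congrArg (· * φ (j + 1))
    (dualQHahnWeight_contiguity_succ σ hq hq1 hρ hi (Nat.lt_succ_iff.1 (Finset.mem_range.1 hj)))
  simp only [sub_mul, mul_sub, mul_assoc, Finset.sum_sub_distrib, ← Finset.mul_sum] at hS ⊢
  simp only [hw, dualQHahnWeight_zero, Nat.cast_zero, sub_zero, add_zero] at hS ⊢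
  have hz : q ^ ((d : ℤ) + 1) = q ^ (d + 1) := by exact_mod_cast zpow_natCast q (d + 1)
  rw [hz]
  have hI : q⁻¹ * q ^ (i + 1) = q ^ i := by rw [pow_succ]; field_simp
  linear_combination hS + φ 0 * ρ * (1 - q ^ (d + 1)) * hI

theorem qbinom_succ_left {q : ℂ} {d i : ℕ} (hi : i ≤ d)
    (h : 1 - q ^ (d + 1 - i) ≠ 0) :
    qbinom q (d + 1) i * (1 - q ^ (d + 1 - i)) = qbinom q d i * (1 - q ^ (d + 1)) := by
  rw [qbinom, qbinom, if_pos hi, if_pos (by omega), show d + 1 - i = d - i + 1 by omega,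
    qpoch_succ, qpoch_succ]
  rw [show d + 1 - i = d - i + 1 by omega, pow_succ'] at h
  rw [pow_succ', pow_succ']
  field_simp

theorem qbinom_succ_succ {q : ℂ} {d i : ℕ} (hi : i ≤ d) (h : 1 - q ^ (i + 1) ≠ 0) :
    qbinom q (d + 1) (i + 1) * (1 - q ^ (i + 1)) = qbinom q d i * (1 - q ^ (d + 1)) := by
  rw [qbinom, qbinom, if_pos hi, if_pos (by omega), show d + 1 - (i + 1) = d - i by omega,
    qpoch_succ, qpoch_succ]
  rw [pow_succ'] at h
  rw [pow_succ', pow_succ']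
  field_simp

theorem zpow_neg_mul_div_sub_ne_zero {q ρ σ : ℂ} (hq : q ≠ 0) (hσ : σ ≠ 0) {n l : ℕ}
    (hl : l ≤ n) (h : ρ ≠ σ * q ^ (n - l)) : q ^ (-(n : ℤ)) * ρ / σ * q ^ l ≠ 1 := fun h' => by
  refine h ?_
  have hn : q ^ n = q ^ (n - l) * q ^ l := by rw [← pow_add, Nat.sub_add_cancel hl]
  have h1 : q ^ (n - l) ≠ 0 := pow_ne_zero _ hq
  have h2 : q ^ l ≠ 0 := pow_ne_zero _ hq
  rw [zpow_neg, zpow_natCast, hn] at h'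
  field_simp at h'
  rw [h', mul_comm]

theorem dualQHahnCoeff_succ_left {d : ℕ} {q ρ σ : ℂ} (hq : q ≠ 0) (hσ : σ ≠ 0)
    (hq1 : ∀ m : ℕ, 1 ≤ m → m ≤ d + 1 → q ^ m ≠ 1)
    (hρσ : ∀ m : ℕ, 1 ≤ m → m ≤ d + 1 → ρ ≠ σ * q ^ m) {i : ℕ} (hi : i ≤ d) :
    (ρ - σ * q ^ (d + 1)) * ((q ^ (d + 1) - q ^ i) * dualQHahnCoeff (d + 1) ρ σ q i) =
      (1 - q ^ (d + 1)) * (σ * q ^ (d + 1) - q ^ i * ρ) * dualQHahnCoeff d ρ σ q i := by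
  have he : ((i : ℤ) * ((i : ℤ) - 3 - 2 * ((d + 1 : ℕ) : ℤ))) / 2 =
      ((i : ℤ) * ((i : ℤ) - 3 - 2 * (d : ℤ))) / 2 - i := by
    rw [← Int.sub_mul_ediv_right _ _ two_ne_zero]
    congr 1; push_cast; ring
  have hb := qbinom_succ_left (q := q) hi
    (sub_ne_zero.2 (hq1 (d + 1 - i) (by omega) (by omega)).symm)
  have hDi : q ^ (d + 1) = q ^ (d + 1 - i) * q ^ i := by
    rw [← pow_add, Nat.sub_add_cancel (by omega)]
  have hshift : q ^ (-((d + 1 : ℕ) : ℤ)) * ρ / σ * q = q ^ (-(d : ℤ)) * ρ / σ := by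
    simp only [zpow_neg, zpow_natCast, pow_succ]; field_simp
  have hp := qpoch_succ (q ^ (-((d + 1 : ℕ) : ℤ)) * ρ / σ) q i
  rw [qpoch_succ', hshift] at hp
  have hA : qpoch (q ^ (-(d : ℤ)) * ρ / σ) q i ≠ 0 := qpoch_ne_zero fun l hl =>
    zpow_neg_mul_div_sub_ne_zero hq hσ (by omega) (hρσ _ (by omega) (by omega))
  have hB : qpoch (q ^ (-((d + 1 : ℕ) : ℤ)) * ρ / σ) q i ≠ 0 := qpoch_ne_zero fun l hl =>
    zpow_neg_mul_div_sub_ne_zero hq hσ (by omega) (hρσ _ (by omega) (by omega))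
  rw [dualQHahnCoeff, dualQHahnCoeff, he, zpow_sub₀ hq, zpow_natCast]
  generalize qpoch (q ^ (-(d : ℤ)) * ρ / σ) q i = A at *
  generalize qpoch (q ^ (-((d + 1 : ℕ) : ℤ)) * ρ / σ) q i = B at *
  generalize q ^ (((i : ℤ) * ((i : ℤ) - 3 - 2 * (d : ℤ))) / 2) = E
  have hI : q ^ i ≠ 0 := pow_ne_zero _ hq
  have hQ : q ^ (d + 1) ≠ 0 := pow_ne_zero _ hq
  rw [zpow_neg, zpow_natCast] at hp
  have hp' : (σ * q ^ (d + 1) - ρ) * A = B * (σ * q ^ (d + 1) - q ^ i * ρ) := by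
    field_simp at hp
    linear_combination hp
  have hb' : (q ^ (d + 1) - q ^ i) * qbinom q (d + 1) i =
      -(q ^ i * (qbinom q d i * (1 - q ^ (d + 1)))) := by
    rw [← hb]
    linear_combination qbinom q (d + 1) i * hDi
  generalize q ^ (d + 1) = Q at *
  field_simp
  linear_combination E * qpoch (ρ * q) q i *
    ((ρ - σ * Q) * A * hb' + q ^ i * qbinom q d i * (1 - Q) * hp')

theorem dualQHahnCoeff_succ_succ {d : ℕ} {q ρ σ : ℂ} (hq : q ≠ 0) (hσ : σ ≠ 0)
    (hq1 : ∀ m : ℕ, 1 ≤ m → m ≤ d + 1 → q ^ m ≠ 1)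
    (hρσ : ∀ m : ℕ, 1 ≤ m → m ≤ d + 1 → ρ ≠ σ * q ^ m) {i : ℕ} (hi : i ≤ d) :
    (ρ - σ * q ^ (d + 1)) * ((q ^ (i + 1) - 1) * dualQHahnCoeff (d + 1) ρ σ q (i + 1)) =
      -((1 - q ^ (d + 1)) * (q⁻¹ * (1 - ρ * q ^ (i + 1))) * dualQHahnCoeff d ρ σ q i) := by
  have he : (((i + 1 : ℕ) : ℤ) * (((i + 1 : ℕ) : ℤ) - 3 - 2 * ((d + 1 : ℕ) : ℤ))) / 2 =
      ((i : ℤ) * ((i : ℤ) - 3 - 2 * (d : ℤ))) / 2 - (d + 2 : ℕ) := by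
    rw [← Int.sub_mul_ediv_right _ _ two_ne_zero]
    congr 1; push_cast; ring
  have hb := qbinom_succ_succ (q := q) hi
    (sub_ne_zero.2 (hq1 (i + 1) (by omega) (by omega)).symm)
  have hshift : q ^ (-((d + 1 : ℕ) : ℤ)) * ρ / σ * q = q ^ (-(d : ℤ)) * ρ / σ := by
    simp only [zpow_neg, zpow_natCast, pow_succ]; field_simp
  have hA : qpoch (q ^ (-(d : ℤ)) * ρ / σ) q i ≠ 0 := qpoch_ne_zero fun l hl =>
    zpow_neg_mul_div_sub_ne_zero hq hσ (by omega) (hρσ _ (by omega) (by omega))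
  have hQ : q ^ (d + 1) ≠ 0 := pow_ne_zero _ hq
  have hs : σ * q ^ (d + 1) - ρ ≠ 0 := sub_ne_zero.2 (hρσ (d + 1) (by omega) le_rfl).symm
  have h1 : 1 - q ^ (-((d + 1 : ℕ) : ℤ)) * ρ / σ = (σ * q ^ (d + 1) - ρ) / (σ * q ^ (d + 1)) := by
    rw [zpow_neg, zpow_natCast]; field_simp
  rw [dualQHahnCoeff, dualQHahnCoeff, he, zpow_sub₀ hq, zpow_natCast,
    qpoch_succ' (q ^ (-((d + 1 : ℕ) : ℤ)) * ρ / σ), hshift, qpoch_succ (q * ρ), h1]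
  generalize qpoch (q ^ (-(d : ℤ)) * ρ / σ) q i = A at *
  generalize q ^ (((i : ℤ) * ((i : ℤ) - 3 - 2 * (d : ℤ))) / 2) = E
  rw [show q ^ (d + 2) = q ^ (d + 1) * q from pow_succ _ _, pow_succ σ, pow_succ (-1 : ℂ),
    show q * ρ * q ^ i = ρ * q ^ (i + 1) by ring]
  generalize q ^ (d + 1) = Q at *
  generalize q ^ (i + 1) = J at *
  generalize qpoch (q * ρ) q i = P at *
  field_simp
  linear_combination E * P * (ρ - σ * Q) * (1 - ρ * J) * hb

theorem dualQHahn_contiguity_raise (d : ℕ) (q ρ σ : ℂ)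
    (hq : q ≠ 0) (hρ0 : ρ ≠ 0) (hσ0 : σ ≠ 0)
    (hq1 : ∀ m : ℕ, 1 ≤ m → m ≤ d + 1 → q ^ m ≠ 1)
    (hρ : ∀ m : ℕ, 1 ≤ m → m ≤ d + 1 → ρ * q ^ m ≠ 1)
    (hρσ : ∀ m : ℕ, 1 ≤ m → m ≤ d + 1 → ρ ≠ σ * q ^ m)
    (x i : ℕ) (hx : x ≤ d) (hi : i ≤ d) :
    (q ^ x - q ^ (d + 1)) * (σ * q ^ (d + 1) - q ^ (-1 - (x : ℤ))) / (ρ - σ * q ^ (d + 1)) *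
        dualQHahnP d ρ σ q x (i : ℤ) =
      (q ^ (i + 1) - 1) * dualQHahnP (d + 1) ρ σ q x ((i : ℤ) + 1) +
        (q ^ (d + 1) - q ^ i) * dualQHahnP (d + 1) ρ σ q x (i : ℤ) := by
  rw [show ((i : ℤ) + 1) = ((i + 1 : ℕ) : ℤ) by push_cast; rfl,
    dualQHahnP_natCast hq d ρ σ x (show i < i + 2 by omega),
    dualQHahnP_natCast hq (d + 1) ρ σ x (show i + 1 < i + 2 by omega),
    dualQHahnP_natCast hq (d + 1) ρ σ x (show i < i + 2 by omega)]
  have hs : ρ - σ * q ^ (d + 1) ≠ 0 := sub_ne_zero.2 (hρσ (d + 1) (by omega) le_rfl)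
  have h0 := dualQHahnWeight_sum_contiguity σ hq hq1 hρ x hi
  have h1 := dualQHahnCoeff_succ_left hq hσ0 hq1 hρσ hi
  have h2 := dualQHahnCoeff_succ_succ hq hσ0 hq1 hρσ hi
  rw [div_mul_eq_mul_div, div_eq_iff hs]
  generalize ∑ k ∈ Finset.range (i + 2),
    dualQHahnWeight d ρ q i k * dualQHahnBasis σ q x k = F at *
  generalize ∑ k ∈ Finset.range (i + 2),
    dualQHahnWeight (d + 1) ρ q i k * dualQHahnBasis σ q x k = G at *
  generalize ∑ k ∈ Finset.range (i + 2),
    dualQHahnWeight (d + 1) ρ q (i + 1) k * dualQHahnBasis σ q x k = H at *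
  linear_combination (-dualQHahnCoeff d ρ σ q i) * h0 - G * h1 - H * h2
end

section
/- With the Hahn/dual-Hahn Tratnik functions T_{i,j}(x,y) as defined, for every (i,j) ∈ D there exists a bivariate polynomial P(u,v) with complex coefficients, of total degree i + j (where both u and v are assigned degree 1) and of degree exactly j in the variable v, such that T_{i,j}(x,y) = P(x, y(y+1+σ+x)) for all (x,y) ∈ D. In particular, T_{i,j} is a bivariate polynomial of total degree i + j in the variables x and y(y+1+σ+x). -/
/-- Pochhammer symbol `(a)_k = a (a+1) ⋯ (a+k-1)`. -/
noncomputable def poch (a : ℂ) (k : ℕ) : ℂ := ∏ l ∈ Finset.range k, (a + l)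

/-- The hypergeometric-type sum `h(i,j,x)` entering the Hahn part. -/
noncomputable def hSum (N : ℕ) (r s : ℂ) (i j x : ℕ) : ℂ :=
  ∑ k ∈ Finset.range (min i x + 1),
    poch (-(i : ℂ)) k * poch ((i : ℂ) + 1 + s + j) k * poch (-(x : ℂ)) k /
      (poch (r + 1) k * poch (-(N : ℂ) + j) k * (k.factorial : ℂ))

/-- The hypergeometric-type sum `h'(j,x,y)` entering the dual Hahn part. -/
noncomputable def hSum' (N : ℕ) (ρ σ : ℂ) (j x y : ℕ) : ℂ :=
  ∑ k ∈ Finset.range (min j y + 1),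
    poch (-(j : ℂ)) k * poch (-(y : ℂ)) k * poch ((y : ℂ) + 1 + σ + x) k /
      (poch (ρ + 1) k * poch (-(N : ℂ) + x) k * (k.factorial : ℂ))

/-- The Hahn / dual Hahn Tratnik function `T_{i,j}(x,y)`. -/
noncomputable def tratnikT (N : ℕ) (r s ρ σ : ℂ) (i j x y : ℕ) : ℂ :=
  ((N - j).choose i : ℂ) * ((N - x).choose j : ℂ) * (-1 : ℂ) ^ j * poch (r + 1) i *
      poch (2 + s + j) (N - j) * poch (ρ + 1) j /
      (poch (s + j - r + 1) i * poch (s + j + 1 + i) i * poch (s + j + 2 * i + 2) (N - j - i) *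
        poch (ρ - σ - N) j) *
    hSum N r s i j x * hSum' N ρ σ j x y

/-- The weight function `F(x,y)`. -/
noncomputable def wF (N : ℕ) (r s ρ σ : ℂ) (x y : ℕ) : ℂ :=
  (N.factorial : ℂ) / ((x.factorial : ℂ) * (y.factorial : ℂ) * ((N - x - y).factorial : ℂ)) *
    ((-1 : ℂ) ^ (N - y) * poch (r + 1) x * poch (ρ + 1) y * poch (ρ - N - σ) (N - x - y)) /
    (poch (σ + x + y + 1) y * poch (σ + x + 2 * y + 2) (N - x - y) * poch (r - s - N) x)

/-- The weight function `G(i,j)`. -/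
noncomputable def wG (N : ℕ) (r s ρ σ : ℂ) (i j : ℕ) : ℂ :=
  (N.factorial : ℂ) / ((i.factorial : ℂ) * (j.factorial : ℂ) * ((N - i - j).factorial : ℂ)) *
    (poch (r + 1) i * (poch (2 + s + j) (N - j)) ^ 2 * poch (ρ + 1) j) /
    (poch (s + j - r + 1) i * poch (s + j + 1 + i) i * poch (s + j + 2 * i + 2) (N - j - i) *
      poch (ρ - σ - N) j * poch (r - s - N) (N - j))

open MvPolynomial in
lemma degreeOf_sum_range_succ_eq {τ : Type*} {R : Type*} [CommSemiring R] (n : τ)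
    (f : ℕ → MvPolynomial τ R) (d : ℕ) (hlt : ∀ k < d, (f k).degreeOf n < d)
    (hd : (f d).degreeOf n = d) :
    (∑ k ∈ Finset.range (d + 1), f k).degreeOf n = d := by
  rw [Finset.sum_range_succ, add_comm]
  rcases Nat.eq_zero_or_pos d with rfl | hpos
  · simpa using hd
  · rw [degreeOf_add_eq_of_degreeOf_lt, hd]
    rw [hd]
    refine (degreeOf_sum_le n _ f).trans_lt ?_
    exact (Finset.sup_lt_iff (by simpa using hpos)).2 fun k hk => hlt k (Finset.mem_range.1 hk)

open MvPolynomial in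
lemma degreeOf_C_mul_prod_range {τ : Type*} {R : Type*} [CommRing R] [IsDomain R] (n : τ)
    {c : R} (hc : c ≠ 0) (f : ℕ → MvPolynomial τ R) (d : ℕ) (hf : ∀ l, (f l).degreeOf n = 1) :
    (C c * ∏ l ∈ Finset.range d, f l).degreeOf n = d := by
  rw [degreeOf_C_mul _ _ (mem_nonZeroDivisors_of_ne_zero hc), degreeOf_prod_eq]
  · simp [hf]
  · exact fun l _ => ne_zero_of_degreeOf_ne_zero (i := n) (by simp [hf])

lemma poch_ne_zero {a : ℂ} {k : ℕ} (h : ∀ l < k, a + l ≠ 0) : poch a k ≠ 0 :=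
  Finset.prod_ne_zero_iff.2 fun l hl => h l (Finset.mem_range.1 hl)

lemma poch_neg_natCast_ne_zero {n k : ℕ} (h : k ≤ n) : poch (-(n : ℂ)) k ≠ 0 := by
  refine poch_ne_zero fun l hl h0 => ?_
  have : (l : ℂ) = n := by linear_combination h0
  have : l = n := by exact_mod_cast this
  omega

lemma poch_neg_natCast_eq_zero {n k : ℕ} (h : n < k) : poch (-(n : ℂ)) k = 0 :=
  Finset.prod_eq_zero (Finset.mem_range.2 h) (by simp)

lemma poch_neg (a : ℂ) (k : ℕ) :
    poch (-a) k = (-1) ^ k * ∏ l ∈ Finset.range k, (a - l) := by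
  rw [poch, ← Finset.card_range k, ← Finset.prod_const, Finset.card_range,
    ← Finset.prod_mul_distrib]
  exact Finset.prod_congr rfl fun l _ => by ring

lemma natCast_choose_mul_factorial (n j : ℕ) :
    (n.choose j : ℂ) * (j.factorial : ℂ) = ∏ l ∈ Finset.range j, ((n : ℂ) - l) := by
  rw [← Nat.cast_mul, mul_comm, ← Nat.descFactorial_eq_factorial_mul_choose,
    ← descPochhammer_eval_eq_descFactorial, descPochhammer_eval_eq_prod_range]

lemma choose_div_poch_neg {n j k : ℕ} (hkj : k ≤ j) (hkn : k ≤ n) :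
    (n.choose j : ℂ) / poch (-(n : ℂ)) k =
      (-1) ^ k / (j.factorial : ℂ) * ∏ l ∈ Finset.Ico k j, ((n : ℂ) - l) := by
  have hj : (j.factorial : ℂ) ≠ 0 := by exact_mod_cast j.factorial_ne_zero
  have hp := poch_neg_natCast_ne_zero hkn
  have hsq : ((-1 : ℂ) ^ k) * (-1) ^ k = 1 := by rw [← mul_pow]; simp
  rw [div_mul_eq_mul_div, div_eq_div_iff hp hj, natCast_choose_mul_factorial,
    ← Finset.prod_range_mul_prod_Ico _ hkj, poch_neg]
  linear_combination (-(∏ l ∈ Finset.range k, ((n : ℂ) - l)) *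
    ∏ l ∈ Finset.Ico k j, ((n : ℂ) - l)) * hsq

lemma poch_neg_mul_poch (y c : ℂ) (k : ℕ) :
    poch (-y) k * poch (y + c) k =
      ∏ l ∈ Finset.range k, ((l : ℂ) * (c + l) - y * (y + c)) := by
  rw [poch, poch, ← Finset.prod_mul_distrib]
  exact Finset.prod_congr rfl fun l _ => by ring

/-- The Hahn sum `hSum` as a polynomial in the first variable. -/
noncomputable def hahnPoly (N : ℕ) (r s : ℂ) (i j : ℕ) : MvPolynomial (Fin 2) ℂ :=
  ∑ k ∈ Finset.range (i + 1),
    MvPolynomial.C (poch (-(i : ℂ)) k * poch ((i : ℂ) + 1 + s + j) k /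
        (poch (r + 1) k * poch (-(N : ℂ) + j) k * (k.factorial : ℂ))) *
      ∏ l ∈ Finset.range k, (MvPolynomial.C (l : ℂ) - MvPolynomial.X 0)

/-- The dual Hahn sum `hSum'` multiplied by `binom(N-x, j)`, as a polynomial in `x` and
`y(y+1+σ+x)`. -/
noncomputable def dualHahnPoly (N : ℕ) (ρ σ : ℂ) (j : ℕ) : MvPolynomial (Fin 2) ℂ :=
  ∑ k ∈ Finset.range (j + 1),
    MvPolynomial.C (poch (-(j : ℂ)) k * (-1) ^ k /
        (poch (ρ + 1) k * (k.factorial : ℂ) * (j.factorial : ℂ))) *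
      (∏ l ∈ Finset.range k, (MvPolynomial.C ((l : ℂ) * (1 + σ + l)) +
          MvPolynomial.C (l : ℂ) * MvPolynomial.X 0 - MvPolynomial.X 1)) *
      ∏ l ∈ Finset.Ico k j, (MvPolynomial.C ((N : ℂ) - l) - MvPolynomial.X 0)

lemma eval_hahnPoly (N : ℕ) (r s : ℂ) (i j x : ℕ) (v : ℂ) :
    MvPolynomial.eval ![(x : ℂ), v] (hahnPoly N r s i j) = hSum N r s i j x := by
  rw [hahnPoly, hSum, map_sum]
  symm
  have hsub : Finset.range (min i x + 1) ⊆ Finset.range (i + 1) :=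
    Finset.range_mono (by omega)
  rw [Finset.sum_subset hsub]
  · refine Finset.sum_congr rfl fun k _ => ?_
    have : ∏ l ∈ Finset.range k, ((l : ℂ) - x) = poch (-(x : ℂ)) k :=
      Finset.prod_congr rfl fun l _ => by ring
    simp only [map_mul, map_prod, map_sub, MvPolynomial.eval_C, MvPolynomial.eval_X,
      Matrix.cons_val_zero, this]
    ring
  · intro k hk hk'
    simp only [Finset.mem_range] at hk hk'
    rw [poch_neg_natCast_eq_zero (n := x) (by omega)]
    simp

lemma eval_dualHahnPoly {N x y : ℕ} (ρ σ : ℂ) (j : ℕ) (hxy : x + y ≤ N) :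
    MvPolynomial.eval ![(x : ℂ), (y : ℂ) * ((y : ℂ) + 1 + σ + (x : ℂ))] (dualHahnPoly N ρ σ j) =
      ((N - x).choose j : ℂ) * hSum' N ρ σ j x y := by
  have hcast : ((N - x : ℕ) : ℂ) = (N : ℂ) - x := by
    rw [Nat.cast_sub (by omega)]
  have heval : ∀ k, MvPolynomial.eval ![(x : ℂ), (y : ℂ) * ((y : ℂ) + 1 + σ + (x : ℂ))]
      (MvPolynomial.C (poch (-(j : ℂ)) k * (-1) ^ k /
        (poch (ρ + 1) k * (k.factorial : ℂ) * (j.factorial : ℂ))) *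
      (∏ l ∈ Finset.range k, (MvPolynomial.C ((l : ℂ) * (1 + σ + l)) +
          MvPolynomial.C (l : ℂ) * MvPolynomial.X 0 - MvPolynomial.X 1)) *
      ∏ l ∈ Finset.Ico k j, (MvPolynomial.C ((N : ℂ) - l) - MvPolynomial.X 0)) =
      poch (-(j : ℂ)) k * (-1) ^ k / (poch (ρ + 1) k * (k.factorial : ℂ) * (j.factorial : ℂ)) *
      (poch (-(y : ℂ)) k * poch ((y : ℂ) + 1 + σ + x) k) *
      ∏ l ∈ Finset.Ico k j, (((N - x : ℕ) : ℂ) - l) := by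
    intro k
    rw [show (y : ℂ) + 1 + σ + x = y + (1 + σ + x) by ring, poch_neg_mul_poch]
    simp only [map_mul, map_prod, map_sub, map_add, MvPolynomial.eval_C, MvPolynomial.eval_X,
      Matrix.cons_val_zero, Matrix.cons_val_one]
    congr 1
    · congr 1
      exact Finset.prod_congr rfl fun l _ => by ring
    · exact Finset.prod_congr rfl fun l _ => by rw [hcast]; ring
  rw [dualHahnPoly, hSum', map_sum, Finset.mul_sum]
  symm
  have hsub : Finset.range (min j y + 1) ⊆ Finset.range (j + 1) :=
    Finset.range_mono (by omega)
  refine Finset.sum_subset_zero_on_sdiff hsub ?_ ?_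
  · intro k hk
    simp only [Finset.mem_sdiff, Finset.mem_range] at hk
    rw [heval, poch_neg_natCast_eq_zero (n := y) (by omega)]
    simp
  · intro k hk
    simp only [Finset.mem_range] at hk
    rw [heval, show -(N : ℂ) + x = -((N - x : ℕ) : ℂ) by rw [hcast]; ring]
    have h := choose_div_poch_neg (n := N - x) (j := j) (k := k) (by omega) (by omega)
    calc _ = poch (-(j : ℂ)) k * poch (-(y : ℂ)) k * poch ((y : ℂ) + 1 + σ + x) k /
          (poch (ρ + 1) k * (k.factorial : ℂ)) *
          (((N - x).choose j : ℂ) / poch (-((N - x : ℕ) : ℂ)) k) := by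
            simp only [div_eq_mul_inv, mul_inv]; ring
      _ = _ := by
            rw [h]; simp only [div_eq_mul_inv, mul_inv]; ring

section Degrees

open MvPolynomial

lemma degreeOf_zero_C_sub_X (a : ℂ) : (C a - X 0 : MvPolynomial (Fin 2) ℂ).degreeOf 0 = 1 := by
  rw [sub_eq_add_neg, add_comm, degreeOf_add_eq_of_degreeOf_lt] <;> simp [degreeOf_neg]

lemma degreeOf_one_C_sub_X (a : ℂ) : (C a - X 0 : MvPolynomial (Fin 2) ℂ).degreeOf 1 = 0 := by
  have h := degreeOf_sub_le 1 (C a : MvPolynomial (Fin 2) ℂ) (X 0)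
  simpa [degreeOf_X] using h

lemma totalDegree_C_sub_X_le (a : ℂ) :
    (C a - X 0 : MvPolynomial (Fin 2) ℂ).totalDegree ≤ 1 := by
  simpa using totalDegree_sub (C a : MvPolynomial (Fin 2) ℂ) (X 0)

lemma totalDegree_dualHahn_factor_le (a b : ℂ) :
    (C a + C b * X 0 - X 1 : MvPolynomial (Fin 2) ℂ).totalDegree ≤ 1 := by
  refine (totalDegree_sub _ _).trans (max_le ((totalDegree_add _ _).trans (max_le ?_ ?_)) ?_)
  · simp
  · exact (totalDegree_mul _ _).trans (by simp)
  · simp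

lemma degreeOf_one_dualHahn_factor (a b : ℂ) :
    (C a + C b * X 0 - X 1 : MvPolynomial (Fin 2) ℂ).degreeOf 1 = 1 := by
  have h : (C a + C b * X 0 : MvPolynomial (Fin 2) ℂ).degreeOf 1 = 0 := by
    have h1 := degreeOf_add_le 1 (C a : MvPolynomial (Fin 2) ℂ) (C b * X 0)
    have h2 := degreeOf_C_mul_le (X 0 : MvPolynomial (Fin 2) ℂ) 1 b
    simp only [degreeOf_C, degreeOf_X] at h1 h2
    simp_all
  rw [sub_eq_add_neg, add_comm, degreeOf_add_eq_of_degreeOf_lt] <;> simp [degreeOf_neg, h]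

lemma totalDegree_prod_le_card {ι τ R : Type*} [CommSemiring R] (t : Finset ι)
    (f : ι → MvPolynomial τ R) (hf : ∀ l, (f l).totalDegree ≤ 1) :
    (∏ l ∈ t, f l).totalDegree ≤ t.card := by
  refine (totalDegree_finsetProd t f).trans ((Finset.sum_le_sum fun l _ => hf l).trans ?_)
  simp

lemma degreeOf_prod_eq_zero {ι τ R : Type*} [CommSemiring R] (n : τ) (t : Finset ι)
    (f : ι → MvPolynomial τ R) (hf : ∀ l, (f l).degreeOf n = 0) :
    (∏ l ∈ t, f l).degreeOf n = 0 :=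
  Nat.le_zero.1 ((degreeOf_prod_le n t f).trans (by simp [hf]))

lemma degreeOf_one_hahnPoly (N : ℕ) (r s : ℂ) (i j : ℕ) :
    (hahnPoly N r s i j).degreeOf 1 = 0 := by
  refine Nat.le_zero.1 ((degreeOf_sum_le _ _ _).trans (Finset.sup_le fun k _ => ?_))
  refine (degreeOf_C_mul_le _ _ _).trans ?_
  rw [degreeOf_prod_eq_zero _ _ _ fun l => degreeOf_one_C_sub_X _]

lemma totalDegree_hahnPoly {N : ℕ} {r s : ℂ} {i j : ℕ} (hij : i + j ≤ N)
    (hr : poch (r + 1) i ≠ 0) (hs : poch ((i : ℂ) + 1 + s + j) i ≠ 0) :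
    (hahnPoly N r s i j).totalDegree = i := by
  apply le_antisymm
  · refine totalDegree_finsetSum_le fun k hk => (totalDegree_mul _ _).trans ?_
    have h := totalDegree_prod_le_card (Finset.range k)
      (fun l => (C (l : ℂ) - X 0 : MvPolynomial (Fin 2) ℂ)) fun l => totalDegree_C_sub_X_le _
    simp only [Finset.mem_range, Finset.card_range] at hk h
    rw [totalDegree_C]
    omega
  · have hdeg : (hahnPoly N r s i j).degreeOf 0 = i := by
      refine degreeOf_sum_range_succ_eq 0 _ i (fun k hk => ?_) ?_
      · refine (degreeOf_C_mul_le _ _ _).trans_lt ((degreeOf_prod_le _ _ _).trans_lt ?_)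
        simpa only [degreeOf_zero_C_sub_X, Finset.sum_const, Finset.card_range, smul_eq_mul,
          mul_one] using hk
      · refine degreeOf_C_mul_prod_range 0 ?_ _ i fun l => degreeOf_zero_C_sub_X _
        have hN : poch (-(N : ℂ) + j) i ≠ 0 := by
          have h := poch_neg_natCast_ne_zero (n := N - j) (k := i) (by omega)
          rwa [Nat.cast_sub (by omega), neg_sub, sub_eq_neg_add] at h
        have hf : (i.factorial : ℂ) ≠ 0 := by exact_mod_cast i.factorial_ne_zero
        exact div_ne_zero (mul_ne_zero (poch_neg_natCast_ne_zero le_rfl) hs)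
          (mul_ne_zero (mul_ne_zero hr hN) hf)
    exact hdeg.symm.le.trans (degreeOf_le_totalDegree _ _)

lemma degreeOf_one_dualHahnPoly (N : ℕ) {ρ : ℂ} (σ : ℂ) {j : ℕ} (hρ : poch (ρ + 1) j ≠ 0) :
    (dualHahnPoly N ρ σ j).degreeOf 1 = j := by
  refine degreeOf_sum_range_succ_eq 1 _ j (fun k hk => ?_) ?_
  · refine (degreeOf_mul_le _ _ _).trans_lt ?_
    rw [degreeOf_prod_eq_zero _ _ _ fun l => degreeOf_one_C_sub_X _, add_zero]
    refine (degreeOf_C_mul_le _ _ _).trans_lt ((degreeOf_prod_le _ _ _).trans_lt ?_)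
    simpa only [degreeOf_one_dualHahn_factor, Finset.sum_const, Finset.card_range, smul_eq_mul,
      mul_one] using hk
  · rw [Finset.Ico_self, Finset.prod_empty, mul_one]
    refine degreeOf_C_mul_prod_range 1 ?_ _ j fun l => degreeOf_one_dualHahn_factor _ _
    have hf : (j.factorial : ℂ) ≠ 0 := by exact_mod_cast j.factorial_ne_zero
    exact div_ne_zero (mul_ne_zero (poch_neg_natCast_ne_zero le_rfl) (by simp))
      (mul_ne_zero (mul_ne_zero hρ hf) hf)

lemma totalDegree_dualHahnPoly (N : ℕ) {ρ : ℂ} (σ : ℂ) {j : ℕ} (hρ : poch (ρ + 1) j ≠ 0) :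
    (dualHahnPoly N ρ σ j).totalDegree = j := by
  apply le_antisymm
  · refine totalDegree_finsetSum_le fun k hk => (totalDegree_mul _ _).trans ?_
    have h1 := totalDegree_prod_le_card (Finset.range k)
      (fun l => (C ((l : ℂ) * (1 + σ + l)) + C (l : ℂ) * X 0 - X 1 : MvPolynomial (Fin 2) ℂ))
      fun l => totalDegree_dualHahn_factor_le _ _
    have h2 := totalDegree_prod_le_card (Finset.Ico k j)
      (fun l => (C ((N : ℂ) - l) - X 0 : MvPolynomial (Fin 2) ℂ))
      fun l => totalDegree_C_sub_X_le _
    have h3 := totalDegree_mul (C (poch (-(j : ℂ)) k * (-1) ^ k /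
        (poch (ρ + 1) k * (k.factorial : ℂ) * (j.factorial : ℂ))))
      (∏ l ∈ Finset.range k,
        (C ((l : ℂ) * (1 + σ + l)) + C (l : ℂ) * X 0 - X 1 : MvPolynomial (Fin 2) ℂ))
    rw [totalDegree_C] at h3
    simp only [Finset.mem_range, Finset.card_range, Nat.card_Ico] at hk h1 h2
    omega
  · exact (degreeOf_one_dualHahnPoly N σ hρ).symm.le.trans (degreeOf_le_totalDegree _ _)

lemma hahnPoly_ne_zero {N : ℕ} {r s : ℂ} {i j : ℕ} (hij : i + j ≤ N)
    (hr : poch (r + 1) i ≠ 0) (hs : poch ((i : ℂ) + 1 + s + j) i ≠ 0) :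
    hahnPoly N r s i j ≠ 0 := by
  intro h
  have hi := totalDegree_hahnPoly hij hr hs
  rw [h, totalDegree_zero] at hi
  subst hi
  simp [hahnPoly, poch] at h

lemma dualHahnPoly_ne_zero (N : ℕ) {ρ : ℂ} (σ : ℂ) {j : ℕ} (hρ : poch (ρ + 1) j ≠ 0) :
    dualHahnPoly N ρ σ j ≠ 0 := by
  intro h
  have hj := totalDegree_dualHahnPoly N σ hρ
  rw [h, totalDegree_zero] at hj
  subst hj
  simp [dualHahnPoly, poch] at h

end Degrees

theorem tratnik_is_bivariate_polynomial (N : ℕ) (hN : 0 < N) (r s ρ σ : ℂ)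
    (hs : ∀ m : ℕ, 1 ≤ m → m ≤ 2 * N + 2 → s + (m : ℂ) ≠ 0)
    (hσ : ∀ m : ℕ, 1 ≤ m → m ≤ 2 * N + 2 → σ + (m : ℂ) ≠ 0)
    (hr : ∀ m : ℕ, 1 ≤ m → m ≤ N + 1 → r + (m : ℂ) ≠ 0)
    (hρ : ∀ m : ℕ, 1 ≤ m → m ≤ N + 1 → ρ + (m : ℂ) ≠ 0)
    (hsr : ∀ m : ℕ, m ≤ 2 * N + 1 → s - r + (m : ℂ) ≠ 0)
    (hσρ : ∀ m : ℕ, m ≤ 2 * N + 1 → σ - ρ + (m : ℂ) ≠ 0)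
    (i j : ℕ) (hij : i + j ≤ N) :
    ∃ P : MvPolynomial (Fin 2) ℂ,
      P.totalDegree = i + j ∧ P.degreeOf 1 = j ∧
      ∀ x y : ℕ, x + y ≤ N →
        tratnikT N r s ρ σ i j x y =
          MvPolynomial.eval ![(x : ℂ), (y : ℂ) * ((y : ℂ) + 1 + σ + (x : ℂ))] P := by
  have hs' : ∀ m : ℕ, 1 ≤ m → m ≤ 2 * N + 2 → ∀ z : ℂ, z = s + m → z ≠ 0 :=
    fun m h1 h2 z hz => hz ▸ hs m h1 h2
  have hr0 : poch (r + 1) i ≠ 0 := poch_ne_zero fun l hl => by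
    have h := hr (l + 1) (by omega) (by omega)
    push_cast at h
    rwa [add_right_comm, add_assoc]
  have hρ0 : poch (ρ + 1) j ≠ 0 := poch_ne_zero fun l hl => by
    have h := hρ (l + 1) (by omega) (by omega)
    push_cast at h
    rwa [add_right_comm, add_assoc]
  have hs1 : poch ((i : ℂ) + 1 + s + j) i ≠ 0 := poch_ne_zero fun l hl =>
    hs' (i + 1 + j + l) (by omega) (by omega) _ (by push_cast; ring)
  have hs2 : poch (2 + s + j) (N - j) ≠ 0 := poch_ne_zero fun l hl =>
    hs' (2 + j + l) (by omega) (by omega) _ (by push_cast; ring)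
  have hs3 : poch (s + j + 1 + i) i ≠ 0 := poch_ne_zero fun l hl =>
    hs' (j + 1 + i + l) (by omega) (by omega) _ (by push_cast; ring)
  have hs4 : poch (s + j + 2 * i + 2) (N - j - i) ≠ 0 := poch_ne_zero fun l hl =>
    hs' (j + 2 * i + 2 + l) (by omega) (by omega) _ (by push_cast; ring)
  have hsr0 : poch (s + j - r + 1) i ≠ 0 := poch_ne_zero fun l hl h0 =>
    hsr (j + 1 + l) (by omega) (by push_cast; linear_combination h0)
  have hσρ0 : poch (ρ - σ - N) j ≠ 0 := poch_ne_zero fun l hl h0 =>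
    hσρ (N - l) (by omega) (by
      rw [Nat.cast_sub (by omega)]
      linear_combination -h0)
  have hch : ((N - j).choose i : ℂ) ≠ 0 := by
    exact_mod_cast (Nat.choose_pos (by omega : i ≤ N - j)).ne'
  set c : ℂ := ((N - j).choose i : ℂ) * (-1 : ℂ) ^ j * poch (r + 1) i *
      poch (2 + s + j) (N - j) * poch (ρ + 1) j /
      (poch (s + j - r + 1) i * poch (s + j + 1 + i) i * poch (s + j + 2 * i + 2) (N - j - i) *
        poch (ρ - σ - N) j) with hc
  have hc0 : c ≠ 0 := by
    have h1 : (-1 : ℂ) ^ j ≠ 0 := by simp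
    rw [hc]
    exact div_ne_zero (mul_ne_zero (mul_ne_zero (mul_ne_zero (mul_ne_zero hch h1) hr0) hs2) hρ0)
      (mul_ne_zero (mul_ne_zero (mul_ne_zero hsr0 hs3) hs4) hσρ0)
  have hH := hahnPoly_ne_zero hij hr0 hs1
  have hQ := dualHahnPoly_ne_zero N σ hρ0
  have hC : (MvPolynomial.C c : MvPolynomial (Fin 2) ℂ) ≠ 0 := by simpa using hc0
  refine ⟨MvPolynomial.C c * (hahnPoly N r s i j * dualHahnPoly N ρ σ j), ?_, ?_, ?_⟩
  · rw [MvPolynomial.totalDegree_mul_of_isDomain hC (mul_ne_zero hH hQ),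
      MvPolynomial.totalDegree_mul_of_isDomain hH hQ, MvPolynomial.totalDegree_C,
      totalDegree_hahnPoly hij hr0 hs1, totalDegree_dualHahnPoly N σ hρ0, zero_add]
  · rw [MvPolynomial.degreeOf_C_mul _ _ (mem_nonZeroDivisors_of_ne_zero hc0),
      MvPolynomial.degreeOf_mul_eq hH hQ, degreeOf_one_hahnPoly,
      degreeOf_one_dualHahnPoly N σ hρ0, zero_add]
  · intro x y hxy
    rw [map_mul, map_mul, MvPolynomial.eval_C, eval_hahnPoly, eval_dualHahnPoly ρ σ j hxy, hc,
      tratnikT]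
    ring
end

section
/- With the Hahn/dual-Hahn Tratnik functions T_{i,j}(x,y) and the weight function G(i,j) as defined, set b_i(j) = (i+j−N)(i+1+r)(i+1+s*+j) / [ (2i+j+s*+2)(2i+j+s*+1) ], c_i(j) = −i(i+j+s*−r)(i+1+s*+N) / [ (2i+j+s*)(2i+j+s*+1) ], and a_i(j) = −b_i(j) − c_i(j). Then for all (i,j) ∈ D and (x,y) ∈ D the following three-term recurrence relation holds: x · T_{i,j}(x,y) = (G(i,j)/G(i+1,j)) · b_i(j) · T_{i+1,j}(x,y) + a_i(j) · T_{i,j}(x,y) + (G(i,j)/G(i−1,j)) · c_i(j) · T_{i−1,j}(x,y), with the conventions that the term involving T_{i+1,j} is omitted when i = N − j (its coefficient b_{N−j}(j) vanishes) and the term involving T_{i−1,j} is omitted when i = 0 (its coefficient c_0(j) vanishes). -/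
/-- Recurrence coefficient `b_i(j)`. -/
noncomputable def coeffb (N : ℕ) (r s : ℂ) (i j : ℕ) : ℂ :=
  ((i : ℂ) + j - N) * ((i : ℂ) + 1 + r) * ((i : ℂ) + 1 + s + j) /
    ((2 * (i : ℂ) + j + s + 2) * (2 * (i : ℂ) + j + s + 1))

/-- Recurrence coefficient `c_i(j)`. -/
noncomputable def coeffc (N : ℕ) (r s : ℂ) (i j : ℕ) : ℂ :=
  -((i : ℂ) * ((i : ℂ) + j + s - r) * ((i : ℂ) + 1 + s + N)) /
    ((2 * (i : ℂ) + j + s) * (2 * (i : ℂ) + j + s + 1))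

lemma poch_zero (a : ℂ) : poch a 0 = 1 := by simp [poch]

lemma poch_succ (a : ℂ) (k : ℕ) : poch a (k + 1) = poch a k * (a + k) := by
  simp [poch, Finset.prod_range_succ]

lemma poch_succ_left (a : ℂ) (k : ℕ) : poch a (k + 1) = a * poch (a + 1) k := by
  simp only [poch, Finset.prod_range_succ', Nat.cast_zero, add_zero, mul_comm a]
  congr 1
  refine Finset.prod_congr rfl fun l _ => ?_
  push_cast
  ring

/-- The degree-dependent factor of the `k`-th term of a Hahn polynomial. -/
noncomputable def hahnFactor (u : ℂ) (i k : ℕ) : ℂ :=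
  poch (-(i : ℂ)) k * poch ((i : ℂ) + 1 + u) k

lemma hahnFactor_succ_right (u : ℂ) (i k : ℕ) :
    hahnFactor u i (k + 1) = (k - i) * (i + u + k + 1) * hahnFactor u i k := by
  simp only [hahnFactor, poch_succ]
  ring

lemma hahnFactor_succ_sub (u : ℂ) (i k : ℕ) :
    (i + 1 + u) * (hahnFactor u (i + 1) (k + 1) - hahnFactor u i (k + 1)) =
      -((k + 1) * (2 * i + 2 + u) * (i + u + k + 1) * hahnFactor u i k) := by
  have h1 : poch (-((i + 1 : ℕ) : ℂ)) (k + 1) = (-i - 1) * poch (-(i : ℂ)) k := by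
    rw [poch_succ_left]
    push_cast
    ring_nf
  have h2 : (i + 1 + u) * poch (((i + 1 : ℕ) : ℂ) + 1 + u) k =
      poch ((i : ℂ) + 1 + u) k * (i + u + k + 1) := by
    have := (poch_succ_left ((i : ℂ) + 1 + u) k).symm.trans (poch_succ _ k)
    push_cast
    rw [show (i : ℂ) + 1 + 1 + u = i + 1 + u + 1 by ring, this]
    ring
  simp only [hahnFactor, h1, poch_succ _ k]
  push_cast at h2 ⊢
  linear_combination (-i - 1) * poch (-(i : ℂ)) k * (i + 1 + 1 + u + k) * h2

lemma hahnFactor_sub_succ (u : ℂ) (i k : ℕ) :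
    (i + 1) * (hahnFactor u i (k + 1) - hahnFactor u (i + 1) (k + 1)) =
      -((k + 1) * (2 * i + 2 + u) * (k - i - 1) * hahnFactor u (i + 1) k) := by
  have h1 : (i + 1) * poch (-(i : ℂ)) k = -(poch (-((i + 1 : ℕ) : ℂ)) k * (k - i - 1)) := by
    have := (poch_succ_left (-((i + 1 : ℕ) : ℂ)) k).symm.trans (poch_succ _ k)
    push_cast at this ⊢
    rw [show -((i : ℂ) + 1) + 1 = -i by ring] at this
    linear_combination -this
  have h2 : poch ((i : ℂ) + 1 + u) (k + 1) =
      (i + 1 + u) * poch (((i + 1 : ℕ) : ℂ) + 1 + u) k := by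
    rw [poch_succ_left]
    push_cast
    ring_nf
  rw [hahnFactor, hahnFactor, hahnFactor, h2, poch_succ, poch_succ, poch_succ]
  push_cast at h1 ⊢
  linear_combination (poch ((i : ℂ) + 1 + 1 + u) k) * (i + 1 + u) * (k - i) * h1

lemma coeffb_eq_zero {N i j : ℕ} (r s : ℂ) (h : i + j = N) : coeffb N r s i j = 0 := by
  simp [coeffb, ← h]

lemma coeffb_mul_hahnFactor_sub {N i j : ℕ} {r s : ℂ} (k : ℕ)
    (h1 : 2 * (i : ℂ) + j + s + 1 ≠ 0) (h2 : 2 * (i : ℂ) + j + s + 2 ≠ 0) :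
    coeffb N r s i j *
        (hahnFactor (s + j) (i + 1) (k + 1) - hahnFactor (s + j) i (k + 1)) =
      -((k + 1) * (i + j - N) * (i + 1 + r) * (i + (s + j) + k + 1) /
        (2 * i + j + s + 1) * hahnFactor (s + j) i k) := by
  have h := hahnFactor_succ_sub (s + j) i k
  unfold coeffb
  generalize hd : 2 * (i : ℂ) + j + s + 1 = d at h1 ⊢
  generalize he : 2 * (i : ℂ) + j + s + 2 = e at h2 ⊢
  field_simp
  subst hd he
  linear_combination ((i : ℂ) + j - N) * (i + 1 + r) * h

lemma coeffc_mul_hahnFactor_sub {N i j : ℕ} {r s : ℂ} (k : ℕ)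
    (h0 : i ≠ 0 → 2 * (i : ℂ) + j + s ≠ 0) (h1 : 2 * (i : ℂ) + j + s + 1 ≠ 0) :
    coeffc N r s i j *
        (hahnFactor (s + j) (i - 1) (k + 1) - hahnFactor (s + j) i (k + 1)) =
      (k + 1) * (i + j + s - r) * (i + 1 + s + N) * (k - i) /
        (2 * i + j + s + 1) * hahnFactor (s + j) i k := by
  rcases i with _ | i
  · rcases k with _ | k
    · simp [coeffc]
    · simp [coeffc, hahnFactor, poch_succ_left]
  · have h := hahnFactor_sub_succ (s + j) i k
    have h0 := h0 i.succ_ne_zero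
    unfold coeffc
    rw [Nat.add_sub_cancel]
    push_cast at h h0 h1 ⊢
    generalize hahnFactor (s + j) i (k + 1) = P, hahnFactor (s + j) (i + 1) k = Q,
      hahnFactor (s + j) (i + 1) (k + 1) = R at h ⊢
    generalize hd : 2 * ((i : ℂ) + 1) + j + s + 1 = d at h1 ⊢
    generalize he : 2 * ((i : ℂ) + 1) + j + s = e at h0 ⊢
    field_simp
    subst hd he
    linear_combination -((i : ℂ) + 1 + j + s - r) * (i + 1 + 1 + s + N) * h

lemma hahnFactor_recurrence {N i j : ℕ} {r s : ℂ} (k : ℕ)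
    (h0 : i ≠ 0 → 2 * (i : ℂ) + j + s ≠ 0) (h1 : 2 * (i : ℂ) + j + s + 1 ≠ 0)
    (h2 : 2 * (i : ℂ) + j + s + 2 ≠ 0) :
    (k + 1) * hahnFactor (s + j) i (k + 1) -
        (k + 1) * (r + 1 + k) * (-N + j + k) * hahnFactor (s + j) i k =
      coeffb N r s i j *
          (hahnFactor (s + j) (i + 1) (k + 1) - hahnFactor (s + j) i (k + 1)) +
        coeffc N r s i j *
          (hahnFactor (s + j) (i - 1) (k + 1) - hahnFactor (s + j) i (k + 1)) := by
  rw [coeffb_mul_hahnFactor_sub k h1 h2, coeffc_mul_hahnFactor_sub k h0 h1,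
    hahnFactor_succ_right]
  generalize hahnFactor (s + j) i k = P
  generalize hd : 2 * (i : ℂ) + j + s + 1 = d at h1 ⊢
  field_simp
  subst hd
  ring

/-- The degree-independent factor of the `k`-th term of a Hahn polynomial. -/
noncomputable def hahnWeight (N : ℕ) (r : ℂ) (j x k : ℕ) : ℂ :=
  poch (-(x : ℂ)) k / (poch (r + 1) k * poch (-(N : ℂ) + j) k * (k.factorial : ℂ))

lemma hSum_eq_sum_range (N : ℕ) (r s : ℂ) (i j x : ℕ) :
    hSum N r s i j x =
      ∑ k ∈ Finset.range (x + 1), hahnFactor (s + j) i k * hahnWeight N r j x k := by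
  have : hSum N r s i j x = ∑ k ∈ Finset.range (min i x + 1),
      hahnFactor (s + j) i k * hahnWeight N r j x k :=
    Finset.sum_congr rfl fun k _ => by
      simp only [hahnFactor, hahnWeight, ← add_assoc]
      ring
  rw [this]
  refine Finset.sum_subset (Finset.range_mono (by omega)) fun k hk hk' => ?_
  simp only [Finset.mem_range] at hk hk'
  rw [hahnFactor, poch_neg_natCast_eq_zero (by omega), zero_mul, zero_mul]

lemma hahnWeight_succ_mul {N j x k : ℕ} {r : ℂ} (hr : r + 1 + k ≠ 0)
    (hN : -(N : ℂ) + j + k ≠ 0) :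
    (k + 1) * (r + 1 + k) * (-N + j + k) * hahnWeight N r j x (k + 1) =
      (k - x) * hahnWeight N r j x k := by
  have hk : (k : ℂ) + 1 ≠ 0 := Nat.cast_add_one_ne_zero k
  simp only [hahnWeight, poch_succ, Nat.factorial_succ]
  push_cast
  rw [mul_div_assoc', mul_div_assoc',
    ← mul_div_mul_left ((k - x : ℂ) * poch (-(x : ℂ)) k) _
      (mul_ne_zero (mul_ne_zero hk hr) hN)]
  congr 1 <;> ring

/-- The three-term recurrence relation of the Hahn polynomials. -/
lemma hSum_recurrence {N i j x : ℕ} {r s : ℂ} (hx : x + j ≤ N)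
    (h0 : i ≠ 0 → 2 * (i : ℂ) + j + s ≠ 0) (h1 : 2 * (i : ℂ) + j + s + 1 ≠ 0)
    (h2 : 2 * (i : ℂ) + j + s + 2 ≠ 0) (hr : ∀ k < x, r + 1 + (k : ℂ) ≠ 0) :
    (x : ℂ) * hSum N r s i j x =
      coeffb N r s i j * (hSum N r s (i + 1) j x - hSum N r s i j x) +
        coeffc N r s i j * (hSum N r s (i - 1) j x - hSum N r s i j x) := by
  have hN : ∀ k < x, -(N : ℂ) + j + k ≠ 0 := fun k hk h => by
    have h : ((j + k : ℕ) : ℂ) = N := by push_cast; linear_combination h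
    have := Nat.cast_injective h
    omega
  set P := hahnFactor (s + j) with hP
  set w := hahnWeight N r j x with hw
  have hsum : ∑ k ∈ Finset.range (x + 1), ((k : ℂ) - x) * (P i k * w k) =
      ∑ k ∈ Finset.range x, (k + 1) * (r + 1 + k) * (-N + j + k) * P i k * w (k + 1) := by
    rw [Finset.sum_range_succ, sub_self, zero_mul, add_zero]
    refine Finset.sum_congr rfl fun k hk => ?_
    rw [Finset.mem_range] at hk
    linear_combination (-(P i k)) * hahnWeight_succ_mul (x := x) (hr k hk) (hN k hk)
  have hdiff : ∑ k ∈ Finset.range (x + 1), (k : ℂ) * (P i k * w k) -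
      ∑ k ∈ Finset.range x, (k + 1) * (r + 1 + k) * (-N + j + k) * P i k * w (k + 1) =
      ∑ k ∈ Finset.range (x + 1), (coeffb N r s i j * (P (i + 1) k - P i k) +
        coeffc N r s i j * (P (i - 1) k - P i k)) * w k := by
    rw [Finset.sum_range_succ', Finset.sum_range_succ' _ x, Nat.cast_zero, zero_mul, add_zero,
      ← Finset.sum_sub_distrib]
    simp only [hP, hahnFactor, poch_zero, sub_self, mul_zero, add_zero, zero_mul]
    refine Finset.sum_congr rfl fun k _ => ?_
    have := hahnFactor_recurrence (N := N) (r := r) k h0 h1 h2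
    simp only [hahnFactor] at this
    rw [← this]
    push_cast
    ring
  simp only [hSum_eq_sum_range, ← hP, ← hw]
  rw [← hsum, ← Finset.sum_sub_distrib] at hdiff
  calc _ = ∑ k ∈ Finset.range (x + 1),
        ((k : ℂ) * (P i k * w k) - ((k : ℂ) - x) * (P i k * w k)) := by
        rw [Finset.mul_sum]
        exact Finset.sum_congr rfl fun k _ => by ring
    _ = _ := by
        rw [hdiff, ← Finset.sum_sub_distrib, ← Finset.sum_sub_distrib, Finset.mul_sum,
          Finset.mul_sum, ← Finset.sum_add_distrib]
        exact Finset.sum_congr rfl fun k _ => by ring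

lemma wG_ne_zero {N : ℕ} {r s ρ σ : ℂ}
    (hs : ∀ m : ℕ, 1 ≤ m → m ≤ 2 * N + 2 → s + (m : ℂ) ≠ 0)
    (hr : ∀ m : ℕ, 1 ≤ m → m ≤ N + 1 → r + (m : ℂ) ≠ 0)
    (hρ : ∀ m : ℕ, 1 ≤ m → m ≤ N + 1 → ρ + (m : ℂ) ≠ 0)
    (hsr : ∀ m : ℕ, m ≤ 2 * N + 1 → s - r + (m : ℂ) ≠ 0)
    (hσρ : ∀ m : ℕ, m ≤ 2 * N + 1 → σ - ρ + (m : ℂ) ≠ 0)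
    {i j : ℕ} (hij : i + j ≤ N) : wG N r s ρ σ i j ≠ 0 := by
  have p1 : poch (r + 1) i ≠ 0 := poch_ne_zero fun l hl h =>
    hr (l + 1) (by omega) (by omega) (by push_cast; linear_combination h)
  have p2 : poch (2 + s + j) (N - j) ≠ 0 := poch_ne_zero fun l hl h =>
    hs (2 + j + l) (by omega) (by omega) (by push_cast; linear_combination h)
  have p3 : poch (ρ + 1) j ≠ 0 := poch_ne_zero fun l hl h =>
    hρ (l + 1) (by omega) (by omega) (by push_cast; linear_combination h)
  have p4 : poch (s + j - r + 1) i ≠ 0 := poch_ne_zero fun l hl h =>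
    hsr (j + l + 1) (by omega) (by push_cast; linear_combination h)
  have p5 : poch (s + j + 1 + i) i ≠ 0 := poch_ne_zero fun l hl h =>
    hs (j + 1 + i + l) (by omega) (by omega) (by push_cast; linear_combination h)
  have p6 : poch (s + j + 2 * i + 2) (N - j - i) ≠ 0 := poch_ne_zero fun l hl h =>
    hs (j + 2 * i + 2 + l) (by omega) (by omega) (by push_cast; linear_combination h)
  have p7 : poch (ρ - σ - N) j ≠ 0 := poch_ne_zero fun l hl h =>
    hσρ (N - l) (by omega) (by rw [Nat.cast_sub (by omega)]; linear_combination -h)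
  have p8 : poch (r - s - N) (N - j) ≠ 0 := poch_ne_zero fun l hl h =>
    hsr (N - l) (by omega) (by rw [Nat.cast_sub (by omega)]; linear_combination -h)
  simp only [wG, ne_eq, div_eq_zero_iff, mul_eq_zero, pow_eq_zero_iff two_ne_zero, Nat.cast_eq_zero,
    Nat.factorial_ne_zero, p1, p2, p3, p4, p5, p6, p7, p8, or_self, not_false_eq_true]

lemma tratnikT_eq_wG_mul {N : ℕ} {r s : ℂ} (ρ σ : ℂ)
    (hs : ∀ m : ℕ, 1 ≤ m → m ≤ 2 * N + 2 → s + (m : ℂ) ≠ 0)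
    (hsr : ∀ m : ℕ, m ≤ 2 * N + 1 → s - r + (m : ℂ) ≠ 0)
    {i j : ℕ} (x y : ℕ) (hij : i + j ≤ N) :
    tratnikT N r s ρ σ i j x y = wG N r s ρ σ i j *
      (((N - x).choose j : ℂ) * (-1) ^ j * (N - j).factorial * j.factorial / N.factorial *
        poch (r - s - N) (N - j) / poch (2 + s + j) (N - j) * hSum' N ρ σ j x y) *
      hSum N r s i j x := by
  have p2 : poch (2 + s + j) (N - j) ≠ 0 := poch_ne_zero fun l hl h =>
    hs (2 + j + l) (by omega) (by omega) (by push_cast; linear_combination h)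
  have p8 : poch (r - s - N) (N - j) ≠ 0 := poch_ne_zero fun l hl h =>
    hsr (N - l) (by omega) (by rw [Nat.cast_sub (by omega)]; linear_combination -h)
  have f (n : ℕ) : (n.factorial : ℂ) ≠ 0 := Nat.cast_ne_zero.2 n.factorial_ne_zero
  rw [tratnikT, wG, Nat.cast_choose ℂ (show i ≤ N - j by omega), Nat.sub_right_comm N i j]
  generalize poch (s + j - r + 1) i * poch (s + j + 1 + i) i *
    poch (s + j + 2 * i + 2) (N - j - i) * poch (ρ - σ - N) j = d
  have fN := f N
  have fj := f j
  field_simp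

theorem tratnik_recurrence_relation (N : ℕ) (hN : 0 < N) (r s ρ σ : ℂ)
    (hs : ∀ m : ℕ, 1 ≤ m → m ≤ 2 * N + 2 → s + (m : ℂ) ≠ 0)
    (hσ : ∀ m : ℕ, 1 ≤ m → m ≤ 2 * N + 2 → σ + (m : ℂ) ≠ 0)
    (hr : ∀ m : ℕ, 1 ≤ m → m ≤ N + 1 → r + (m : ℂ) ≠ 0)
    (hρ : ∀ m : ℕ, 1 ≤ m → m ≤ N + 1 → ρ + (m : ℂ) ≠ 0)
    (hsr : ∀ m : ℕ, m ≤ 2 * N + 1 → s - r + (m : ℂ) ≠ 0)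
    (hσρ : ∀ m : ℕ, m ≤ 2 * N + 1 → σ - ρ + (m : ℂ) ≠ 0)
    (i j x y : ℕ) (hij : i + j ≤ N) (hxy : x + y ≤ N) :
    (x : ℂ) * tratnikT N r s ρ σ i j x y =
      wG N r s ρ σ i j / wG N r s ρ σ (i + 1) j * coeffb N r s i j *
          tratnikT N r s ρ σ (i + 1) j x y +
        (-coeffb N r s i j - coeffc N r s i j) * tratnikT N r s ρ σ i j x y +
        wG N r s ρ σ i j / wG N r s ρ σ (i - 1) j * coeffc N r s i j *
          tratnikT N r s ρ σ (i - 1) j x y := by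
  have h0 : i ≠ 0 → 2 * (i : ℂ) + j + s ≠ 0 := fun hi h =>
    hs (2 * i + j) (by omega) (by omega) (by push_cast; linear_combination h)
  have h1 : 2 * (i : ℂ) + j + s + 1 ≠ 0 := fun h =>
    hs (2 * i + j + 1) (by omega) (by omega) (by push_cast; linear_combination h)
  have h2 : 2 * (i : ℂ) + j + s + 2 ≠ 0 := fun h =>
    hs (2 * i + j + 2) (by omega) (by omega) (by push_cast; linear_combination h)
  by_cases hx : x + j ≤ N
  swap
  · have hT (n : ℕ) : tratnikT N r s ρ σ n j x y = 0 := by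
      simp [tratnikT, Nat.choose_eq_zero_of_lt (show N - x < j by omega)]
    simp [hT]
  have hrec := hSum_recurrence (i := i) (r := r) hx h0 h1 h2 fun k hk h =>
    hr (k + 1) (by omega) (by omega) (by push_cast; linear_combination h)
  set K := ((N - x).choose j : ℂ) * (-1) ^ j * (N - j).factorial * j.factorial / N.factorial *
    poch (r - s - N) (N - j) / poch (2 + s + j) (N - j) * hSum' N ρ σ j x y
  have hT (n : ℕ) (hn : n + j ≤ N) :
      tratnikT N r s ρ σ n j x y = wG N r s ρ σ n j * K * hSum N r s n j x :=
    tratnikT_eq_wG_mul ρ σ hs hsr x y hn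
  have hG (n : ℕ) (hn : n + j ≤ N) (c : ℂ) :
      wG N r s ρ σ i j / wG N r s ρ σ n j * c * tratnikT N r s ρ σ n j x y =
        wG N r s ρ σ i j * K * (c * hSum N r s n j x) := by
    rw [hT n hn]
    have := wG_ne_zero hs hr hρ hsr hσρ hn
    field_simp
  have hb : wG N r s ρ σ i j / wG N r s ρ σ (i + 1) j * coeffb N r s i j *
      tratnikT N r s ρ σ (i + 1) j x y =
        wG N r s ρ σ i j * K * (coeffb N r s i j * hSum N r s (i + 1) j x) := by
    rcases hij.eq_or_lt with h | h
    · simp [coeffb_eq_zero r s h]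
    · exact hG _ (by omega) _
  rw [hb, hG (i - 1) (by omega), hT i hij]
  linear_combination wG N r s ρ σ i j * K * hrec
end
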